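/- Suppose γ > 0, t₀ ≥ 0, B ≥ K, and z₁ ∈ ℝ, t ≥ t₀ are such that H(z₁,t) ≤ −B and Ω(z₁,s) ≥ γ for every s ∈ [t₀,t], where H(z₁,s) := z₁ + Φ(z₁,s). Then 1 ≥ ∂_{z₁}H(z₁,t) ≥ 1 − (t₀ + γ^{−1}) e^{K−B}; equivalently, 0 ≥ ∂_{z₁}Φ(z₁,t) = −(1/2)∫₀ᵗ∫_{ℝ} ω₀(z₁, z₂ − Φ(z₁,s))/cosh(z₂) dz₂ ds ≥ −(t₀ + γ^{−1}) e^{K−B}. -/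

import Mathlib

open MeasureTheory Real

/-- `IsGlobalSolution ω₀ Φ`: `Φ` is a global solution of the hyperbolic 2D Euler
equation in `z`-coordinates with data `ω₀`: it is continuous on `ℝ × [0,∞)`, bounded
on `ℝ × [0,T]` for every `T > 0`, and with `ω(z₁,z₂,t) := ω₀(z₁, z₂ - Φ(z₁,t))` it
satisfies `Φ(z₁,t) = (1/2)∫₀ᵗ ∫_{z₁}^∞ ∫_ℝ ω(z̃₁,z₂,s)/cosh(z₂) dz₂ dz̃₁ ds`. -/
def IsGlobalSolution (ω₀ : ℝ × ℝ → ℝ) (Φ : ℝ → ℝ → ℝ) : Prop :=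
  ContinuousOn (fun p : ℝ × ℝ => Φ p.1 p.2) (Set.univ ×ˢ Set.Ici (0:ℝ)) ∧
  (∀ T : ℝ, 0 < T → ∃ M, ∀ z₁ : ℝ, ∀ t ∈ Set.Icc (0:ℝ) T, |Φ z₁ t| ≤ M) ∧
  ∀ (z₁ t : ℝ), 0 ≤ t →
    Φ z₁ t = (1 / 2) * ∫ s in (0:ℝ)..t, ∫ w in Set.Ioi z₁, ∫ z₂ : ℝ,
      ω₀ (w, z₂ - Φ w s) / Real.cosh z₂

/-- The velocity amplitude
`Ω(z₁,t) = (1/4)∫_{z₁}^∞ ∫_ℝ ω₀(z̃₁, z₂ - Φ(z̃₁,t))/cosh(z₂) dz₂ dz̃₁`. -/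
noncomputable def Omeg (ω₀ : ℝ × ℝ → ℝ) (Φ : ℝ → ℝ → ℝ) (z₁ t : ℝ) : ℝ :=
  (1 / 4) * ∫ w in Set.Ioi z₁, ∫ z₂ : ℝ, ω₀ (w, z₂ - Φ w t) / Real.cosh z₂

theorem Real.inv_cosh_le_two_mul_exp (z : ℝ) : (cosh z)⁻¹ ≤ 2 * exp z := by
  rw [inv_le_iff_one_le_mul₀ (cosh_pos z), cosh_eq]
  have h : exp z * exp (-z) = 1 := by rw [← exp_add]; simp
  nlinarith [sq_nonneg (exp z)]

theorem Real.integrable_inv_cosh : Integrable (fun z : ℝ => (cosh z)⁻¹) := by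
  have hm : Continuous fun z : ℝ => (cosh z)⁻¹ :=
    continuous_cosh.inv₀ fun z => (cosh_pos z).ne'
  rw [← integrableOn_univ, ← Set.Iic_union_Ioi (a := (0 : ℝ))]
  refine IntegrableOn.union ?_ ?_
  · refine Integrable.mono' ((integrableOn_exp_Iic 0).const_mul 2)
      hm.aestronglyMeasurable (.of_forall fun z => ?_)
    rw [norm_of_nonneg (inv_pos.2 (cosh_pos z)).le]
    exact inv_cosh_le_two_mul_exp z
  · refine Integrable.mono' ((integrableOn_exp_neg_Ioi 0).const_mul 2)
      hm.aestronglyMeasurable (.of_forall fun z => ?_)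
    rw [norm_of_nonneg (inv_pos.2 (cosh_pos z)).le, ← cosh_neg]
    exact inv_cosh_le_two_mul_exp (-z)

/-- The integral over the line `{w} × ℝ` of the data shifted up by `φ`, weighted by `1 / cosh`. -/
noncomputable def weightedFiber (ω₀ : ℝ × ℝ → ℝ) (w φ : ℝ) : ℝ :=
  ∫ z : ℝ, ω₀ (w, z - φ) / cosh z

section WeightedFiber

variable {ω₀ : ℝ × ℝ → ℝ}

theorem div_cosh_le_inv_cosh (hrange : ∀ z, 0 ≤ ω₀ z ∧ ω₀ z ≤ 1) (p : ℝ × ℝ) (z : ℝ) :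
    ω₀ p / cosh z ≤ (cosh z)⁻¹ := by
  rw [div_eq_mul_inv]
  exact mul_le_of_le_one_left (inv_pos.2 (cosh_pos z)).le (hrange p).2

theorem norm_div_cosh_le (hrange : ∀ z, 0 ≤ ω₀ z ∧ ω₀ z ≤ 1) (p : ℝ × ℝ) (z : ℝ) :
    ‖ω₀ p / cosh z‖ ≤ (cosh z)⁻¹ := by
  rw [norm_of_nonneg (div_nonneg (hrange p).1 (cosh_pos z).le)]
  exact div_cosh_le_inv_cosh hrange p z

theorem continuous_div_cosh (hcont : Continuous ω₀) (w φ : ℝ) :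
    Continuous fun z : ℝ => ω₀ (w, z - φ) / cosh z :=
  (hcont.comp (by fun_prop)).div continuous_cosh fun z => (cosh_pos z).ne'

theorem integrable_div_cosh (hcont : Continuous ω₀) (hrange : ∀ z, 0 ≤ ω₀ z ∧ ω₀ z ≤ 1)
    (w φ : ℝ) : Integrable fun z : ℝ => ω₀ (w, z - φ) / cosh z :=
  integrable_inv_cosh.mono' (continuous_div_cosh hcont w φ).aestronglyMeasurable
    (.of_forall fun z => norm_div_cosh_le hrange _ z)

theorem continuous_weightedFiber (hcont : Continuous ω₀)
    (hrange : ∀ z, 0 ≤ ω₀ z ∧ ω₀ z ≤ 1) :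
    Continuous fun p : ℝ × ℝ => weightedFiber ω₀ p.1 p.2 := by
  refine continuous_of_dominated (bound := fun z => (cosh z)⁻¹)
    (fun p => (continuous_div_cosh hcont p.1 p.2).aestronglyMeasurable)
    (fun p => .of_forall fun z => norm_div_cosh_le hrange _ z) integrable_inv_cosh
    (.of_forall fun z => ?_)
  exact (hcont.comp (by fun_prop)).div_const _

theorem weightedFiber_nonneg (hrange : ∀ z, 0 ≤ ω₀ z ∧ ω₀ z ≤ 1) (w φ : ℝ) :
    0 ≤ weightedFiber ω₀ w φ :=
  integral_nonneg fun z => div_nonneg (hrange _).1 (cosh_pos z).le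

theorem weightedFiber_le (hcont : Continuous ω₀) (hrange : ∀ z, 0 ≤ ω₀ z ∧ ω₀ z ≤ 1)
    (w φ : ℝ) : weightedFiber ω₀ w φ ≤ ∫ z : ℝ, (cosh z)⁻¹ :=
  integral_mono (integrable_div_cosh hcont hrange w φ) integrable_inv_cosh
    fun z => div_cosh_le_inv_cosh hrange _ z

theorem weightedFiber_eq_zero {K : ℝ}
    (hsupp : ∀ z : ℝ × ℝ, ω₀ z ≠ 0 → |z.1 - z.2| ≤ K ∧ z.1 + z.2 ≤ K)
    {w : ℝ} (hw : K < w) (φ : ℝ) : weightedFiber ω₀ w φ = 0 := by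
  have h (y : ℝ) : ω₀ (w, y) = 0 := by
    by_contra hne
    obtain ⟨h₁, h₂⟩ := hsupp _ hne
    dsimp only at h₁ h₂
    linarith [(abs_le.1 h₁).2]
  simp [weightedFiber, h]

theorem weightedFiber_le_two_mul_exp (hcont : Continuous ω₀)
    (hrange : ∀ z, 0 ≤ ω₀ z ∧ ω₀ z ≤ 1) {K : ℝ}
    (hsupp : ∀ z : ℝ × ℝ, ω₀ z ≠ 0 → |z.1 - z.2| ≤ K ∧ z.1 + z.2 ≤ K) (w φ : ℝ) :
    weightedFiber ω₀ w φ ≤ 2 * exp (K + (w + φ)) := by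
  have hint : IntegrableOn (fun z : ℝ => 2 * exp z) (Set.Iic (K + (w + φ))) :=
    (integrableOn_exp_Iic _).const_mul 2
  calc weightedFiber ω₀ w φ
      ≤ ∫ z, (Set.Iic (K + (w + φ))).indicator (fun z => 2 * exp z) z := by
        refine integral_mono (integrable_div_cosh hcont hrange w φ)
          (hint.integrable_indicator measurableSet_Iic) fun z => ?_
        dsimp only
        by_cases hz : z ∈ Set.Iic (K + (w + φ))
        · rw [Set.indicator_of_mem hz]
          exact (div_cosh_le_inv_cosh hrange _ z).trans (inv_cosh_le_two_mul_exp z)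
        · rw [Set.indicator_of_notMem hz]
          have h : ω₀ (w, z - φ) = 0 := by
            by_contra hne
            have h₁ := (hsupp _ hne).1
            dsimp only at h₁
            rw [Set.mem_Iic] at hz
            linarith [(abs_le.1 h₁).1]
          simp [h]
    _ = 2 * exp (K + (w + φ)) := by
        rw [integral_indicator measurableSet_Iic, integral_const_mul, integral_exp_Iic]

theorem continuous_integral_Ioi_weightedFiber (hcont : Continuous ω₀)
    (hrange : ∀ z, 0 ≤ ω₀ z ∧ ω₀ z ≤ 1) {K : ℝ}
    (hsupp : ∀ z : ℝ × ℝ, ω₀ z ≠ 0 → |z.1 - z.2| ≤ K ∧ z.1 + z.2 ≤ K)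
    {Ψ : ℝ → ℝ → ℝ} (hΨ : Continuous fun p : ℝ × ℝ => Ψ p.1 p.2) (a : ℝ) :
    Continuous fun s => ∫ w in Set.Ioi a, weightedFiber ω₀ w (Ψ w s) := by
  have hF : Continuous fun p : ℝ × ℝ => weightedFiber ω₀ p.1 (Ψ p.1 p.2) :=
    (continuous_weightedFiber hcont hrange).comp (continuous_fst.prodMk hΨ)
  refine continuous_of_dominated
    (bound := (Set.Iic K).indicator fun _ => ∫ z : ℝ, (cosh z)⁻¹)
    (fun s => (hF.comp (Continuous.prodMk_left s)).aestronglyMeasurable)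
    (fun s => .of_forall fun w => ?_) ?_
    (.of_forall fun w => hF.comp (Continuous.prodMk_right w))
  · rw [norm_of_nonneg (weightedFiber_nonneg hrange _ _)]
    by_cases hw : w ∈ Set.Iic K
    · rw [Set.indicator_of_mem hw]
      exact weightedFiber_le hcont hrange _ _
    · rw [Set.indicator_of_notMem hw, weightedFiber_eq_zero hsupp (not_le.1 hw)]
  · rw [integrable_indicator_iff measurableSet_Iic, IntegrableOn,
      Measure.restrict_restrict measurableSet_Iic, Set.inter_comm, Set.Ioi_inter_Iic]
    exact integrableOn_const measure_Ioc_lt_top.ne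

end WeightedFiber

namespace IsGlobalSolution

variable {ω₀ : ℝ × ℝ → ℝ} {Φ : ℝ → ℝ → ℝ}

theorem continuous_max (hΦ : IsGlobalSolution ω₀ Φ) :
    Continuous fun p : ℝ × ℝ => Φ p.1 (max p.2 0) :=
  hΦ.1.comp_continuous (f := fun p : ℝ × ℝ => (p.1, max p.2 0)) (by fun_prop)
    fun p => ⟨Set.mem_univ _, Set.mem_Ici.2 (le_max_right p.2 0)⟩

theorem sub_eq_integral_omeg (hcont : Continuous ω₀)
    (hrange : ∀ z, 0 ≤ ω₀ z ∧ ω₀ z ≤ 1) {K : ℝ}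
    (hsupp : ∀ z : ℝ × ℝ, ω₀ z ≠ 0 → |z.1 - z.2| ≤ K ∧ z.1 + z.2 ≤ K)
    (hΦ : IsGlobalSolution ω₀ Φ) (z₁ : ℝ) {s t : ℝ} (hs : 0 ≤ s) (hst : s ≤ t) :
    IntervalIntegrable (Omeg ω₀ Φ z₁) volume s t ∧
      Φ z₁ t - Φ z₁ s = 2 * ∫ r in s..t, Omeg ω₀ Φ z₁ r := by
  have hG := continuous_integral_Ioi_weightedFiber hcont hrange hsupp
    (Ψ := fun w s => Φ w (max s 0)) hΦ.continuous_max z₁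
  have hint {a b : ℝ} (ha : 0 ≤ a) (hab : a ≤ b) :
      IntervalIntegrable (Omeg ω₀ Φ z₁) volume a b := by
    refine ((hG.const_mul (1 / 4)).intervalIntegrable a b).congr fun r hr => ?_
    rw [Set.uIoc_of_le hab] at hr
    simp only [Omeg, weightedFiber, max_eq_left (ha.trans hr.1.le)]
  have hval {b : ℝ} (hb : 0 ≤ b) : Φ z₁ b = 2 * ∫ r in (0 : ℝ)..b, Omeg ω₀ Φ z₁ r := by
    rw [hΦ.2.2 z₁ b hb]
    simp only [Omeg, intervalIntegral.integral_const_mul]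
    ring
  refine ⟨hint hs hst, ?_⟩
  rw [hval (hs.trans hst), hval hs, ← mul_sub,
    intervalIntegral.integral_interval_sub_left (hint le_rfl (hs.trans hst)) (hint le_rfl hs)]

theorem mul_le_sub (hcont : Continuous ω₀)
    (hrange : ∀ z, 0 ≤ ω₀ z ∧ ω₀ z ≤ 1) {K : ℝ}
    (hsupp : ∀ z : ℝ × ℝ, ω₀ z ≠ 0 → |z.1 - z.2| ≤ K ∧ z.1 + z.2 ≤ K)
    (hΦ : IsGlobalSolution ω₀ Φ) {z₁ s t γ : ℝ} (hs : 0 ≤ s) (hst : s ≤ t)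
    (hγ : ∀ r ∈ Set.Icc s t, γ ≤ Omeg ω₀ Φ z₁ r) :
    2 * γ * (t - s) ≤ Φ z₁ t - Φ z₁ s := by
  obtain ⟨hint, heq⟩ := hΦ.sub_eq_integral_omeg hcont hrange hsupp z₁ hs hst
  have h := intervalIntegral.integral_mono_on hst intervalIntegrable_const hint hγ
  rw [intervalIntegral.integral_const, smul_eq_mul] at h
  rw [heq]
  linarith

theorem omeg_nonneg (hrange : ∀ z, 0 ≤ ω₀ z ∧ ω₀ z ≤ 1) (z₁ r : ℝ) : 0 ≤ Omeg ω₀ Φ z₁ r :=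
  mul_nonneg (by norm_num) (integral_nonneg fun w => weightedFiber_nonneg hrange w (Φ w r))

end IsGlobalSolution

theorem integral_exp_mul_sub_le {c : ℝ} (hc : 0 < c) (a b : ℝ) :
    ∫ s in a..b, exp (c * (s - b)) ≤ c⁻¹ := by
  have hd (s : ℝ) : HasDerivAt (fun s => c⁻¹ * exp (c * (s - b))) (exp (c * (s - b))) s := by
    have h := (((hasDerivAt_id' s).sub_const b).const_mul c).exp.const_mul c⁻¹
    rwa [mul_one, mul_comm (exp _) c, inv_mul_cancel_left₀ hc.ne'] at h
  rw [intervalIntegral.integral_eq_sub_of_hasDerivAt (fun s _ => hd s)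
    (Continuous.intervalIntegrable (by fun_prop) _ _)]
  have : 0 < c⁻¹ * exp (c * (a - b)) := by positivity
  simp only [sub_self, mul_zero, exp_zero, mul_one]
  linarith

/-- Structure of the solution past the front: if `H(z₁,t) = z₁ + Φ(z₁,t) ≤ -B` with
`B ≥ K` and `Ω(z₁,s) ≥ γ` for all `s ∈ [t₀,t]`, then
`0 ≥ ∂_{z₁}Φ(z₁,t) = -(1/2)∫₀ᵗ∫_ℝ ω₀(z₁, z₂-Φ(z₁,s))/cosh(z₂) dz₂ ds
  ≥ -(t₀ + γ⁻¹)e^{K-B}`,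
equivalently `1 ≥ ∂_{z₁}H(z₁,t) ≥ 1 - (t₀ + γ⁻¹)e^{K-B}`. -/
theorem stmt_13 (K γ t₀ B z₁ t : ℝ) (hK : 0 < K)
    (ω₀ : ℝ × ℝ → ℝ) (hcont : Continuous ω₀)
    (hrange : ∀ z, 0 ≤ ω₀ z ∧ ω₀ z ≤ 1)
    (hsupp : ∀ z : ℝ × ℝ, ω₀ z ≠ 0 → |z.1 - z.2| ≤ K ∧ z.1 + z.2 ≤ K)
    (Φ : ℝ → ℝ → ℝ) (hΦ : IsGlobalSolution ω₀ Φ)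
    (hderiv : ∀ (w s : ℝ), 0 ≤ s →
      HasDerivAt (fun v => Φ v s)
        (-(1 / 2) * ∫ r in (0:ℝ)..s, ∫ z₂ : ℝ,
          ω₀ (w, z₂ - Φ w r) / Real.cosh z₂) w)
    (hγ : 0 < γ) (ht₀ : 0 ≤ t₀) (hB : K ≤ B) (ht : t₀ ≤ t)
    (hH : z₁ + Φ z₁ t ≤ -B)
    (hΩ : ∀ s ∈ Set.Icc t₀ t, γ ≤ Omeg ω₀ Φ z₁ s) :
    -((t₀ + γ⁻¹) * Real.exp (K - B)) ≤
      -(1 / 2) * ∫ s in (0:ℝ)..t, ∫ z₂ : ℝ,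
        ω₀ (z₁, z₂ - Φ z₁ s) / Real.cosh z₂ ∧
    (-(1 / 2) * ∫ s in (0:ℝ)..t, ∫ z₂ : ℝ,
        ω₀ (z₁, z₂ - Φ z₁ s) / Real.cosh z₂) ≤ 0 := by
  have hJc : Continuous fun s => weightedFiber ω₀ z₁ (Φ z₁ (max s 0)) :=
    (continuous_weightedFiber hcont hrange).comp
      (continuous_const.prodMk (hΦ.continuous_max.comp (Continuous.prodMk_right z₁)))
  have hJ {a b : ℝ} (ha : 0 ≤ a) (hab : a ≤ b) :
      IntervalIntegrable (fun s => weightedFiber ω₀ z₁ (Φ z₁ s)) volume a b := by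
    refine (hJc.intervalIntegrable a b).congr fun r hr => ?_
    rw [Set.uIoc_of_le hab] at hr
    simp only [max_eq_left (ha.trans hr.1.le)]
  have hle (s : ℝ) := weightedFiber_le_two_mul_exp hcont hrange hsupp z₁ (Φ z₁ s)
  have htt : 0 ≤ t := ht₀.trans ht
  have hearly : ∫ s in (0 : ℝ)..t₀, weightedFiber ω₀ z₁ (Φ z₁ s) ≤
      2 * (t₀ * exp (K - B)) := by
    have h := intervalIntegral.integral_mono_on (g := fun _ => 2 * exp (K - B)) ht₀
      (hJ le_rfl ht₀) intervalIntegrable_const fun s hs => by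
        have h₁ := hΦ.mul_le_sub hcont hrange hsupp (z₁ := z₁) hs.1 (hs.2.trans ht)
          fun r _ => IsGlobalSolution.omeg_nonneg hrange z₁ r
        refine (hle s).trans ?_
        gcongr
        linarith
    rw [intervalIntegral.integral_const, smul_eq_mul] at h
    linarith
  have hlate : ∫ s in t₀..t, weightedFiber ω₀ z₁ (Φ z₁ s) ≤
      2 * (exp (K - B) * (2 * γ)⁻¹) := by
    have h := intervalIntegral.integral_mono_on
      (g := fun s => 2 * exp (K - B) * exp (2 * γ * (s - t))) ht (hJ ht₀ ht)
      (Continuous.intervalIntegrable (by fun_prop) _ _) fun s hs => by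
        have h₁ := hΦ.mul_le_sub hcont hrange hsupp (z₁ := z₁) (ht₀.trans hs.1) hs.2
          fun r hr => hΩ r ⟨hs.1.trans hr.1, hr.2⟩
        refine (hle s).trans ?_
        rw [mul_assoc, ← exp_add]
        exact mul_le_mul_of_nonneg_left (exp_le_exp.2 (by linarith)) zero_le_two
    rw [intervalIntegral.integral_const_mul] at h
    refine h.trans ?_
    rw [← mul_assoc]
    gcongr
    exact integral_exp_mul_sub_le (by positivity) _ _
  have hsum := intervalIntegral.integral_add_adjacent_intervals (hJ le_rfl ht₀) (hJ ht₀ ht)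
  have hnonneg : 0 ≤ ∫ s in (0 : ℝ)..t, weightedFiber ω₀ z₁ (Φ z₁ s) :=
    intervalIntegral.integral_nonneg htt fun s _ => weightedFiber_nonneg hrange _ _
  have hhalf : exp (K - B) * (2 * γ)⁻¹ ≤ γ⁻¹ * exp (K - B) := by
    rw [mul_comm]
    gcongr
    linarith
  change _ ≤ -(1 / 2) * (∫ s in (0 : ℝ)..t, weightedFiber ω₀ z₁ (Φ z₁ s)) ∧
    -(1 / 2) * (∫ s in (0 : ℝ)..t, weightedFiber ω₀ z₁ (Φ z₁ s)) ≤ 0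
  constructor <;> linarith
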